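/- Let σ ∈ Λ²₊V be a unit vector. For every unit vector E′ ∈ V and every unit vector E″ ∈ V orthogonal to both E′ and K_σE′, the quadruple (E′, K_σE′, E″, K_σE″) is a positively oriented orthonormal basis of V, and with respect to it σ = E′∧(K_σE′) + E″∧(K_σE″). -/

import Mathlib

open scoped RealInnerProductSpace

open Module

/-- An orthonormal family indexed by a proper subset of `ι` extends to an orthonormal basis with
prescribed orientation. -/
theorem exists_orthonormalBasis_extension_orientation_eq {V ι : Type*}
    [NormedAddCommGroup V] [InnerProductSpace ℝ V] [Fintype ι] [DecidableEq ι]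
    (hd : finrank ℝ V = Fintype.card ι) (hpos : 0 < finrank ℝ V) (o : Orientation ℝ V ι)
    {v : ι → V} {s : Set ι} (hv : Orthonormal ℝ (s.domRestrict v)) {i : ι} (hi : i ∉ s) :
    ∃ b : OrthonormalBasis ι ℝ V, (∀ j ∈ s, b j = v j) ∧ b.toBasis.orientation = o := by
  have : FiniteDimensional ℝ V := FiniteDimensional.of_finrank_pos hpos
  obtain ⟨b, hb⟩ := hv.exists_orthonormalBasis_extension_of_card_eq hd
  rcases b.toBasis.orientation_eq_or_eq_neg o with h | h
  · exact ⟨b, hb, h.symm⟩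
  · let e := b.toBasis.unitsSMul (Function.update 1 i (-1))
    have he : ∀ j, e j = b j ∨ e j = -b j := fun j => by
      by_cases hj : j = i
      · subst hj; right; simp [e, Basis.unitsSMul_apply]
      · left; simp [e, Basis.unitsSMul_apply, hj]
    refine ⟨e.toOrthonormalBasis (b.orthonormal.orthonormal_of_forall_eq_or_eq_neg he), ?_, ?_⟩
    · intro j hj
      have hji : j ≠ i := fun hji => hi (hji ▸ hj)
      simp [e, Basis.unitsSMul_apply, hji, hb j hj]
    · rw [Basis.toBasis_toOrthonormalBasis, Basis.orientation_neg_single, h]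

section Wedge

variable {V L : Type*} [NormedAddCommGroup V] [InnerProductSpace ℝ V]
  [NormedAddCommGroup L] [InnerProductSpace ℝ L] {wedge : V →ₗ[ℝ] V →ₗ[ℝ] L}

/-- A bivector is determined by its inner products with the wedges of basis vectors. -/
theorem ext_inner_wedge_basis {ι : Type*} (b : Basis ι ℝ V)
    (wedge_span : Submodule.span ℝ {x : L | ∃ u v : V, wedge u v = x} = ⊤) {x y : L}
    (h : ∀ i j, ⟪x, wedge (b i) (b j)⟫ = ⟪y, wedge (b i) (b j)⟫) : x = y := by
  have hB : wedge.compr₂ (innerₛₗ ℝ x) = wedge.compr₂ (innerₛₗ ℝ y) :=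
    LinearMap.ext_basis b b fun i j => by simpa using h i j
  have hL : innerₛₗ ℝ x = innerₛₗ ℝ y := by
    refine LinearMap.ext_on wedge_span ?_
    rintro _ ⟨u, v, rfl⟩
    simpa using LinearMap.congr_fun₂ hB u v
  exact ext_inner_right ℝ fun z => by simpa using LinearMap.congr_fun hL z

/-- Expansion of a bivector in the orthogonal basis of wedges of an orthonormal basis. -/
theorem eq_sum_inner_wedge (b : OrthonormalBasis (Fin 4) ℝ V)
    (wedge_self : ∀ v : V, wedge v v = 0)
    (wedge_span : Submodule.span ℝ {x : L | ∃ u v : V, wedge u v = x} = ⊤)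
    (inner_wedge : ∀ v₁ v₂ v₃ v₄ : V,
      ⟪wedge v₁ v₂, wedge v₃ v₄⟫ =
        (1 / 2) * (⟪v₁, v₃⟫ * ⟪v₂, v₄⟫ - ⟪v₁, v₄⟫ * ⟪v₂, v₃⟫)) (x : L) :
    x = (2 * ⟪x, wedge (b 0) (b 1)⟫) • wedge (b 0) (b 1)
      + (2 * ⟪x, wedge (b 0) (b 2)⟫) • wedge (b 0) (b 2)
      + (2 * ⟪x, wedge (b 0) (b 3)⟫) • wedge (b 0) (b 3)
      + (2 * ⟪x, wedge (b 2) (b 3)⟫) • wedge (b 2) (b 3)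
      + (2 * ⟪x, wedge (b 3) (b 1)⟫) • wedge (b 3) (b 1)
      + (2 * ⟪x, wedge (b 1) (b 2)⟫) • wedge (b 1) (b 2) := by
  have hskew : ∀ u v, ⟪x, wedge u v⟫ = -⟪x, wedge v u⟫ := fun u v => by
    rw [← LinearMap.IsAlt.neg wedge_self, inner_neg_right]
  refine ext_inner_wedge_basis b.toBasis wedge_span fun i j => ?_
  fin_cases i <;> fin_cases j <;>
    simp [inner_add_left, inner_smul_left, inner_wedge, wedge_self,
      orthonormal_iff_ite.mp b.orthonormal, -inner_self_eq_norm_sq_to_K] <;>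
    first | ring1 | (rw [hskew]; ring1)

/-- A self-dual bivector is a combination of the three standard self-dual bivectors of a
positively oriented orthonormal basis. -/
theorem exists_eq_of_hodge_eq_self (b : OrthonormalBasis (Fin 4) ℝ V)
    (wedge_self : ∀ v : V, wedge v v = 0)
    (wedge_span : Submodule.span ℝ {x : L | ∃ u v : V, wedge u v = x} = ⊤)
    (inner_wedge : ∀ v₁ v₂ v₃ v₄ : V,
      ⟪wedge v₁ v₂, wedge v₃ v₄⟫ =
        (1 / 2) * (⟪v₁, v₃⟫ * ⟪v₂, v₄⟫ - ⟪v₁, v₄⟫ * ⟪v₂, v₃⟫))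
    {hodge : L →ₗ[ℝ] L} (hodge_hodge : ∀ x : L, hodge (hodge x) = x)
    (h01 : hodge (wedge (b 0) (b 1)) = wedge (b 2) (b 3))
    (h02 : hodge (wedge (b 0) (b 2)) = wedge (b 3) (b 1))
    (h03 : hodge (wedge (b 0) (b 3)) = wedge (b 1) (b 2))
    {σ : L} (hσ : hodge σ = σ) :
    ∃ p q r : ℝ, σ = p • (wedge (b 0) (b 1) + wedge (b 2) (b 3))
      + q • (wedge (b 0) (b 2) + wedge (b 3) (b 1))
      + r • (wedge (b 0) (b 3) + wedge (b 1) (b 2)) := by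
  have h23 : hodge (wedge (b 2) (b 3)) = wedge (b 0) (b 1) := by rw [← h01, hodge_hodge]
  have h31 : hodge (wedge (b 3) (b 1)) = wedge (b 0) (b 2) := by rw [← h02, hodge_hodge]
  have h12 : hodge (wedge (b 1) (b 2)) = wedge (b 0) (b 3) := by rw [← h03, hodge_hodge]
  have hx := eq_sum_inner_wedge b wedge_self wedge_span inner_wedge σ
  have hy := congrArg hodge hx
  simp only [map_add, map_smul, h01, h02, h03, h23, h31, h12, hσ] at hy
  have key : ∀ i j, ⟪σ, wedge (b i) (b j)⟫ = _ := fun i j =>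
    congrArg (fun z => ⟪z, wedge (b i) (b j)⟫) hy
  have e1 := key 0 1
  have e2 := key 0 2
  have e3 := key 0 3
  simp [inner_add_left, inner_smul_left, inner_wedge,
    orthonormal_iff_ite.mp b.orthonormal, -inner_self_eq_norm_sq_to_K] at e1 e2 e3
  refine ⟨2 * ⟪σ, wedge (b 0) (b 1)⟫, 2 * ⟪σ, wedge (b 0) (b 2)⟫,
    2 * ⟪σ, wedge (b 0) (b 3)⟫, hx.trans ?_⟩
  rw [show ⟪σ, wedge (b 2) (b 3)⟫ = ⟪σ, wedge (b 0) (b 1)⟫ by linarith,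
    show ⟪σ, wedge (b 3) (b 1)⟫ = ⟪σ, wedge (b 0) (b 2)⟫ by linarith,
    show ⟪σ, wedge (b 1) (b 2)⟫ = ⟪σ, wedge (b 0) (b 3)⟫ by linarith]
  module

end Wedge

/-- Let `V` be a 4-dimensional oriented real inner product space with Hodge
star `⋆` on `Λ²V`, and let `σ ∈ Λ²₊V` be a unit vector, with `K_σ` defined by
`⟨K_σX, Y⟩ = 2⟨σ, X∧Y⟩`.  For every unit vector `E′ ∈ V` and every unit vector `E″ ∈ V`
orthogonal to both `E′` and `K_σE′`, the quadruple `(E′, K_σE′, E″, K_σE″)` is a positively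
oriented orthonormal basis of `V`, and with respect to it `σ = E′∧(K_σE′) + E″∧(K_σE″)`. -/
theorem stmt_2 {V L : Type*}
    [NormedAddCommGroup V] [InnerProductSpace ℝ V]
    [NormedAddCommGroup L] [InnerProductSpace ℝ L]
    (h4 : Module.finrank ℝ V = 4)
    (o : Orientation ℝ V (Fin 4))
    (wedge : V →ₗ[ℝ] V →ₗ[ℝ] L)
    (wedge_self : ∀ v : V, wedge v v = 0)
    (wedge_span : Submodule.span ℝ {x : L | ∃ u v : V, wedge u v = x} = ⊤)
    (inner_wedge : ∀ v₁ v₂ v₃ v₄ : V,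
      ⟪wedge v₁ v₂, wedge v₃ v₄⟫ =
        (1 / 2) * (⟪v₁, v₃⟫ * ⟪v₂, v₄⟫ - ⟪v₁, v₄⟫ * ⟪v₂, v₃⟫))
    (hodge : L →ₗ[ℝ] L)
    (hodge_hodge : ∀ x : L, hodge (hodge x) = x)
    (hodge_wedge : ∀ b : OrthonormalBasis (Fin 4) ℝ V, b.toBasis.orientation = o →
      hodge (wedge (b 0) (b 1)) = wedge (b 2) (b 3) ∧
      hodge (wedge (b 0) (b 2)) = wedge (b 3) (b 1) ∧
      hodge (wedge (b 0) (b 3)) = wedge (b 1) (b 2))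
    (σ : L) (hσ : hodge σ = σ) (hσ1 : ‖σ‖ = 1)
    (K : V →ₗ[ℝ] V)
    (hK : ∀ X Y : V, ⟪K X, Y⟫ = 2 * ⟪σ, wedge X Y⟫)
    (E' E'' : V) (hE'1 : ‖E'‖ = 1) (hE''1 : ‖E''‖ = 1)
    (hperp1 : ⟪E'', E'⟫ = 0) (hperp2 : ⟪E'', K E'⟫ = 0) :
    (∃ b : OrthonormalBasis (Fin 4) ℝ V,
      b 0 = E' ∧ b 1 = K E' ∧ b 2 = E'' ∧ b 3 = K E'' ∧ b.toBasis.orientation = o) ∧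
    σ = wedge E' (K E') + wedge E'' (K E'') := by
  have hd : finrank ℝ V = Fintype.card (Fin 4) := by simpa using h4
  have hpos : 0 < finrank ℝ V := by omega
  have hext := fun {v : Fin 4 → V} {s : Set (Fin 4)} (hv : Orthonormal ℝ (s.domRestrict v)) =>
    exists_orthonormalBasis_extension_orientation_eq hd hpos o hv (i := 3)
  have hform : ∀ b : OrthonormalBasis (Fin 4) ℝ V, b.toBasis.orientation = o → _ := fun b hb =>
    exists_eq_of_hodge_eq_self b wedge_self wedge_span inner_wedge hodge_hodge
      (hodge_wedge b hb).1 (hodge_wedge b hb).2.1 (hodge_wedge b hb).2.2 hσ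
  have hσσ : ⟪σ, σ⟫ = 1 := by rw [real_inner_self_eq_norm_sq, hσ1]; norm_num
  have hKE : ‖K E'‖ = 1 := by
    obtain ⟨b, hb, hbo⟩ := hext (v := fun _ => E') (s := {0})
      (by simp [hE'1]) (by simp)
    obtain ⟨p, q, r, hs⟩ := hform b hbo
    have hn := hσσ
    have hb0 : b 0 = E' := hb 0 rfl
    have hi : ∀ i, ⟪b i, K E'⟫ = 2 * ⟪σ, wedge (b 0) (b i)⟫ := fun i => by
      rw [real_inner_comm, hK, hb0]
    have hsum := b.sum_sq_norm_inner_right (K E')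
    simp only [hi, Fin.sum_univ_four, hs, wedge_self, Real.norm_eq_abs, sq_abs] at hsum
    rw [hs] at hn
    simp [inner_add_left, inner_add_right, inner_smul_left, inner_smul_right, inner_wedge,
      orthonormal_iff_ite.mp b.orthonormal, -inner_self_eq_norm_sq_to_K] at hn hsum
    have : ‖K E'‖ ^ 2 = 1 := by nlinarith
    nlinarith [norm_nonneg (K E')]
  have hKskew : ⟪K E', E'⟫ = 0 := by rw [hK, wedge_self, inner_zero_right, mul_zero]
  obtain ⟨c, hc, hco⟩ := hext (v := ![E', K E', E'', 0]) (s := {3}ᶜ) (by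
    rw [orthonormal_iff_ite]
    rintro ⟨i, hi⟩ ⟨j, hj⟩
    fin_cases i <;> fin_cases j <;>
      first
      | exact absurd rfl hi
      | exact absurd rfl hj
      | simp [hKE, hE'1, hE''1, hKskew, hperp1, hperp2, real_inner_comm E'',
          real_inner_comm (K E') E']) (by simp)
  have c0 : c 0 = E' := hc 0 (by simp)
  have c1 : c 1 = K E' := hc 1 (by simp)
  have c2 : c 2 = E'' := hc 2 (by simp)
  obtain ⟨p, q, r, hs⟩ := hform c hco
  have hon := orthonormal_iff_ite.mp c.orthonormal
  have hKc : ∀ i j, ⟪K (c i), c j⟫ = _ := fun i j =>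
    (hK (c i) (c j)).trans (congrArg (fun τ => 2 * ⟪τ, wedge (c i) (c j)⟫) hs)
  have hK0 : K (c 0) = c 1 := by rw [c0, c1]
  have k1 := hKc 0 1
  have k2 := hKc 0 2
  have k3 := hKc 0 3
  simp [hK0, inner_add_left, inner_smul_left, inner_wedge, hon,
    -inner_self_eq_norm_sq_to_K] at k1 k2 k3
  have hp : p = 1 := by linarith
  subst hp k2 k3
  have c3 : c 3 = K E'' := by
    rw [← c2]
    refine InnerProductSpace.ext_inner_left_basis c.toBasis fun i => ?_
    rw [c.coe_toBasis, real_inner_comm (K (c 2)), hKc]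
    fin_cases i <;>
      simp [inner_add_left, inner_wedge, hon, wedge_self, -inner_self_eq_norm_sq_to_K]
  refine ⟨⟨c, c0, c1, c2, c3, hco⟩, ?_⟩
  rw [← c1, ← c0, ← c3, ← c2]
  simpa using hs
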